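/- arXiv:1309.6170 — 2 statements merged into one kernel-verified Lean document; each statement's English description precedes it below -/
import Mathlib

section
/- Let n ≥ 3 be odd and let B(B_n) be the n×n integer matrix with B_{i,i+1} = 1 for i odd, B_{i,i+1} = −1 for i even (1 ≤ i ≤ n−1), B_{i+1,i} = −B_{i,i+1} for 1 ≤ i ≤ n−2, B_{n,n−1} = 2, and all other entries 0 (so the last row is (0,…,0,2,0)). Then B(B_n) has rank n−1 over ℚ, and the ℤ-submodule {v ∈ ℤ^n : B(B_n)ᵀ·v = 0} is free of rank 1, generated by the vector G with G_i = 2·(−1)^{(i−1)/2} for i odd with i < n, G_i = 0 for i even, and G_n = (−1)^{(n−1)/2} (i.e. G_n = 1 if n ≡ 1 (mod 4) and G_n = −1 if n ≡ 3 (mod 4)). -/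
open Matrix

/-- The exchange matrix of the bipartite seed of type `B_n` (0-based indices): in 1-based
terms, `B_{i,i+1} = 1` for `i` odd, `B_{i,i+1} = -1` for `i` even, `B_{i+1,i} = -B_{i,i+1}`
for `i ≤ n-2`, `B_{n,n-1} = 2`, and all other entries `0`. -/
def BB (n : ℕ) : Matrix (Fin n) (Fin n) ℤ :=
  Matrix.of fun i j =>
    if (j : ℕ) = (i : ℕ) + 1 then (if (i : ℕ) % 2 = 0 then 1 else -1)
    else if (i : ℕ) = (j : ℕ) + 1 then
      (if (i : ℕ) = n - 1 then 2 else (if (j : ℕ) % 2 = 0 then -1 else 1))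
    else 0

/-- The type `B_n` grading vector: in 1-based terms, `G_i = 2·(-1)^((i-1)/2)` for `i` odd
with `i < n`, `G_i = 0` for `i` even, and `G_n = (-1)^((n-1)/2)`. -/
def gB (n : ℕ) : Fin n → ℤ := fun i =>
  if (i : ℕ) = n - 1 then (if (n - 1) % 4 = 0 then 1 else -1)
  else if (i : ℕ) % 4 = 0 then 2
  else if (i : ℕ) % 4 = 2 then -2
  else 0


section aux
variable {R : Type*} [CommRing R]

lemma BB_col (n : ℕ) (hn3 : 3 ≤ n) (hn : n % 2 = 1) (w : ℕ → R) :
    (((BB n).map (Int.cast : ℤ → R))ᵀ *ᵥ (fun i : Fin n => w i) = 0) ↔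
      (w 1 = 0 ∧ w (n - 2) = 0 ∧ (∀ k, k + 3 < n → w k + w (k + 2) = 0) ∧
        w (n - 3) + 2 * w (n - 1) = 0) := by
  have e0 : (((BB n).map (Int.cast : ℤ → R))ᵀ *ᵥ (fun i : Fin n => w i)) ⟨0, by omega⟩ = - w 1 := by
    simp only [mulVec, dotProduct]
    rw [Fintype.sum_eq_single (⟨1, by omega⟩ : Fin n)]
    · have : ¬ (1 = n - 1) := by omega
      simp [BB, this]
    · rintro ⟨i, hi⟩ h
      have h1 : i ≠ 1 := by simpa using h
      simp [BB, h1]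
  have el : (((BB n).map (Int.cast : ℤ → R))ᵀ *ᵥ (fun i : Fin n => w i)) ⟨n - 1, by omega⟩
      = - w (n - 2) := by
    simp only [mulVec, dotProduct]
    rw [Fintype.sum_eq_single (⟨n - 2, by omega⟩ : Fin n)]
    · have h1 : n - 1 = n - 2 + 1 := by omega
      have h2 : ¬ ((n - 2) % 2 = 0) := by omega
      simp only [BB, transpose_apply, map_apply, of_apply]
      rw [if_pos h1, if_neg h2]; simp
    · rintro ⟨i, hi⟩ h
      have h1 : i ≠ n - 2 := by simpa using h
      simp only [BB, transpose_apply, map_apply, of_apply]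
      rw [if_neg (by omega), if_neg (by omega)]; simp
  have em : ∀ k (hk : k + 2 < n),
      (((BB n).map (Int.cast : ℤ → R))ᵀ *ᵥ (fun i : Fin n => w i)) ⟨k + 1, by omega⟩
      = (if k % 2 = 0 then 1 else -1) * w k +
        (if k + 2 = n - 1 then 2 else if k % 2 = 0 then 1 else -1) * w (k + 2) := by
    intro k hk
    simp only [mulVec, dotProduct]
    rw [Fintype.sum_eq_add (⟨k, by omega⟩ : Fin n) (⟨k + 2, by omega⟩ : Fin n) (by simp)]
    · simp only [BB, transpose_apply, map_apply, of_apply]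
      rw [if_pos trivial, if_neg (by omega : ¬ (k + 1 = k + 2 + 1)), if_pos trivial]
      congr 2
      · split_ifs <;> simp
      · split_ifs <;> first | omega | simp
    · rintro ⟨i, hi⟩ ⟨h, h'⟩
      have h1 : i ≠ k := by simpa using h
      have h2 : i ≠ k + 2 := by simpa using h'
      simp only [BB, transpose_apply, map_apply, of_apply]
      rw [if_neg (by omega), if_neg (by omega)]; simp
  constructor
  · intro h
    rw [h] at e0 el
    refine ⟨by simpa using e0.symm, by simpa using el.symm, fun k hk => ?_, ?_⟩
    · have := em k (by omega)
      rw [h, if_neg (by omega : ¬ (k + 2 = n - 1))] at this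
      simp only [Pi.zero_apply] at this
      split_ifs at this
      · linear_combination -this
      · linear_combination this
    · have := em (n - 3) (by omega)
      rw [h, if_pos (by omega), if_pos (by omega)] at this
      simp only [Pi.zero_apply] at this
      rw [(by omega : n - 3 + 2 = n - 1)] at this
      linear_combination -this
  · rintro ⟨h1, h2, h3, h4⟩
    funext ⟨i, hi⟩
    rcases i with _ | k
    · rw [e0, h1]; simp
    · by_cases hk : k + 2 < n
      · rw [em k hk]
        by_cases hk' : k + 2 = n - 1
        · rw [if_pos hk', if_pos (by omega), hk', Pi.zero_apply, (by omega : k = n - 3)]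
          simpa using h4
        · have := h3 k (by omega)
          rw [if_neg hk']
          simp only [Pi.zero_apply]
          split_ifs
          · linear_combination this
          · linear_combination -this
      · have : k + 1 = n - 1 := by omega
        simp only [this]
        rw [el, h2]; simp

/-- the grading vector on all naturals -/
def gN (m : ℕ) (i : ℕ) : ℤ :=
  if i = 2 * m then (-1) ^ m else if i % 2 = 0 then 2 * (-1) ^ (i / 2) else 0

lemma gB_eq (m : ℕ) (i : Fin (2 * m + 1)) : gB (2 * m + 1) i = gN m i := by
  obtain ⟨i, hi⟩ := i
  simp only [gB, gN, Nat.add_sub_cancel]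
  by_cases h : i = 2 * m
  · rw [if_pos h, if_pos h]
    rcases Nat.even_or_odd m with hm | hm
    · rw [hm.neg_one_pow, if_pos]; obtain ⟨r, rfl⟩ := hm; omega
    · rw [hm.neg_one_pow, if_neg]; obtain ⟨r, rfl⟩ := hm; omega
  · rw [if_neg h, if_neg h]
    by_cases h0 : i % 2 = 0
    · rw [if_pos h0]
      rcases Nat.even_or_odd (i / 2) with hm | hm
      · rw [hm.neg_one_pow, if_pos]; · simp
        obtain ⟨r, hr⟩ := hm; omega
      · rw [hm.neg_one_pow]; obtain ⟨r, hr⟩ := hm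
        rw [if_neg (by omega), if_pos (by omega)]; simp
    · rw [if_neg h0, if_neg (by omega), if_neg (by omega)]

lemma ker_gen (m : ℕ) (hm : 1 ≤ m) (v : Fin (2 * m + 1) → R) :
    (((BB (2 * m + 1)).map (Int.cast : ℤ → R))ᵀ *ᵥ v = 0) ↔
      ∃ c : R, c • (fun i => ((gB (2 * m + 1) i : ℤ) : R)) = v := by
  constructor
  · intro h
    obtain ⟨w, rfl⟩ : ∃ w : ℕ → R, v = fun i : Fin (2 * m + 1) => w i :=
      ⟨fun k => if h : k < 2 * m + 1 then v ⟨k, h⟩ else 0, by funext i; simp only [Fin.is_lt, dif_pos, Fin.eta]⟩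
    rw [BB_col _ (by omega) (by omega)] at h
    obtain ⟨h1, -, h3, h4⟩ := h
    have hodd : ∀ j, 2 * j + 1 < 2 * m + 1 → w (2 * j + 1) = 0 := by
      intro j
      induction j with
      | zero => intro _; exact h1
      | succ j ih =>
        intro hj
        have a := ih (by omega)
        have b := h3 (2 * j + 1) (by omega)
        rw [a, zero_add] at b
        exact b
    have hev : ∀ j, j < m → w (2 * j) = (-1) ^ j * w 0 := by
      intro j
      induction j with
      | zero => intro _; simp
      | succ j ih =>
        intro hj
        have a := ih (by omega)
        have b := h3 (2 * j) (by omega)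
        rw [a] at b
        rw [show 2 * (j + 1) = 2 * j + 2 by ring, pow_succ]
        linear_combination b
    obtain ⟨p, rfl⟩ : ∃ p, m = p + 1 := ⟨m - 1, by omega⟩
    have hp := hev p (by omega)
    rw [show 2 * (p + 1) + 1 - 3 = 2 * p by omega, hp,
      show 2 * (p + 1) + 1 - 1 = 2 * (p + 1) by omega] at h4
    have sq : ∀ q : ℕ, ((-1 : R) ^ q) * (-1) ^ q = 1 := by
      intro q; rw [← mul_pow]; simp
    refine ⟨(-1) ^ (p + 1) * w (2 * (p + 1)), ?_⟩
    funext i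
    simp only [Pi.smul_apply, smul_eq_mul, gB_eq]
    obtain ⟨i, hi⟩ := i
    simp only [gN]
    split_ifs with ha hb
    · subst ha
      push_cast
      linear_combination w (2 * (p + 1)) * sq (p + 1)
    · have := hev (i / 2) (by omega)
      rw [show 2 * (i / 2) = i by omega] at this
      rw [this]
      push_cast
      rw [pow_succ]
      linear_combination (-(-1) ^ (i / 2) * (-1) ^ p) * h4 + (-1) ^ (i / 2) * w 0 * sq p
    · have := hodd (i / 2) (by omega)
      rw [show 2 * (i / 2) + 1 = i by omega] at this
      simp [this]
  · rintro ⟨c, rfl⟩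
    rw [mulVec_smul]
    have : (fun i => ((gB (2 * m + 1) i : ℤ) : R)) =
        fun i : Fin (2 * m + 1) => (fun k : ℕ => ((gN m k : ℤ) : R)) i := by
      funext i; rw [gB_eq]
    rw [this, (BB_col (2 * m + 1) (by omega) (by omega)
      (fun k : ℕ => ((gN m k : ℤ) : R))).2, smul_zero]
    refine ⟨?_, ?_, ?_, ?_⟩
    · simp only [gN]; rw [if_neg (by omega), if_neg (by omega)]; simp
    · simp only [gN]; rw [if_neg (by omega), if_neg (by omega)]; simp
    · intro k hk
      simp only [gN]; rw [if_neg (by omega), if_neg (by omega : ¬ (k + 2 = 2 * m))]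
      rw [show (k + 2) % 2 = k % 2 by omega, show (k + 2) / 2 = k / 2 + 1 by omega]
      split_ifs
      · push_cast; ring
      · simp
    · obtain ⟨p, rfl⟩ : ∃ p, m = p + 1 := ⟨m - 1, by omega⟩
      simp only [gN]
      rw [if_neg (by omega), if_pos (by omega), if_pos (by omega),
        show (2 * (p + 1) + 1 - 3) / 2 = p by omega]
      push_cast; ring

end aux

/-- for odd `n ≥ 3`, the matrix `B(B_n)` has rank `n - 1` over ℚ and the
ℤ-submodule `{v ∈ ℤ^n : B(B_n)ᵀ v = 0}` is free of rank 1, generated by `gB n`. -/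
theorem ker_BB_odd (n : ℕ) (hn3 : 3 ≤ n) (hn : n % 2 = 1) :
    ((BB n).map ((↑) : ℤ → ℚ)).rank = n - 1 ∧
    gB n ≠ 0 ∧
    LinearMap.ker (Matrix.mulVecLin (BB n)ᵀ) = Submodule.span ℤ {gB n} := by
  obtain ⟨m, rfl⟩ : ∃ m, n = 2 * m + 1 := ⟨n / 2, by omega⟩
  have hm : 1 ≤ m := by omega
  have h0 : gB (2 * m + 1) ⟨0, by omega⟩ = 2 := by
    have : ¬ (0 = m) := by omega
    simp [gB, this]
    try omega
  refine ⟨?_, ?_, ?_⟩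
  · rw [← Matrix.rank_transpose]
    have hk : LinearMap.ker (Matrix.mulVecLin ((BB (2 * m + 1)).map ((↑) : ℤ → ℚ))ᵀ) =
        Submodule.span ℚ {fun i => ((gB (2 * m + 1) i : ℤ) : ℚ)} := by
      ext v
      rw [LinearMap.mem_ker, Matrix.mulVecLin_apply, Submodule.mem_span_singleton]
      exact ker_gen m hm v
    have hr := LinearMap.finrank_range_add_finrank_ker
      (Matrix.mulVecLin ((BB (2 * m + 1)).map ((↑) : ℤ → ℚ))ᵀ)
    rw [hk, finrank_span_singleton] at hr
    · rw [Module.finrank_fin_fun] at hr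
      unfold Matrix.rank
      omega
    · intro h
      have := congrFun h ⟨0, by omega⟩
      simp only [h0] at this
      norm_num at this
  · intro h
    rw [h] at h0
    simp at h0
  · ext v
    rw [LinearMap.mem_ker, Matrix.mulVecLin_apply, Submodule.mem_span_singleton]
    have := ker_gen m hm v
    have e : (BB (2 * m + 1)).map (Int.cast : ℤ → ℤ) = BB (2 * m + 1) := by ext; simp
    rw [e] at this
    simpa using this
end

section
/- Let n ≥ 3 be odd and let G ∈ ℤ^n be the vector with G_i = 2·(−1)^{(i−1)/2} for i odd with i < n, G_i = 0 for i even, and G_n = (−1)^{(n−1)/2}. Let Φ ⊆ ℤ^n be the set of almost positive roots of type B_n in simple-root coordinates (with α_n the short simple root): Φ = {−e_i : 1 ≤ i ≤ n} ∪ {e_i + ⋯ + e_{j−1} : 1 ≤ i < j ≤ n} ∪ {e_i + ⋯ + e_n : 1 ≤ i ≤ n} ∪ {e_i + ⋯ + e_{j−1} + 2e_j + ⋯ + 2e_n : 1 ≤ i < j ≤ n}, and for α ∈ Φ set d(α) = −Σ_{l=1}^n α_l·G_l. Then d(α) ∈ {−2, −1, 0, 1, 2} for every α ∈ Φ, and the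 number of α ∈ Φ with d(α) = 2 is (n+1)(n−1)/4, with d(α) = 1 is (n+1)/2, with d(α) = 0 is (n+1)(n−1)/2, with d(α) = −1 is (n+1)/2, and with d(α) = −2 is (n+1)(n−1)/4. In particular this grading of the coefficient-free type B_n cluster algebra is balanced. -/
open Matrix

/-- The negative simple root `-e_i` in simple-root coordinates. -/
def negRoot {n : ℕ} (i : Fin n) : Fin n → ℤ := fun l => if l = i then -1 else 0

/-- The positive root `e_i + ⋯ + e_j` (0-based, `i ≤ j`); these are the roots
`e_i + ⋯ + e_{j-1}` (`i < j ≤ n`) and `e_i + ⋯ + e_n` of type `B_n` in 1-based terms. -/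
def intRoot {n : ℕ} (i j : Fin n) : Fin n → ℤ := fun l => if i ≤ l ∧ l ≤ j then 1 else 0

/-- The positive root `e_i + ⋯ + e_{j-1} + 2e_j + ⋯ + 2e_n` of type `B_n`
(0-based pair `i < j`). -/
def doubRootB {n : ℕ} (i j : Fin n) : Fin n → ℤ := fun l =>
  if i ≤ l ∧ l < j then 1 else if j ≤ l then 2 else 0

/-- The almost positive roots of type `B_n` in simple-root coordinates. -/
def PhiB (n : ℕ) : Finset (Fin n → ℤ) :=
  (Finset.univ.image negRoot) ∪
    (((Finset.univ ×ˢ Finset.univ).filter (fun p : Fin n × Fin n => p.1 ≤ p.2)).image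
      (fun p => intRoot p.1 p.2)) ∪
    (((Finset.univ ×ˢ Finset.univ).filter (fun p : Fin n × Fin n => p.1 < p.2)).image
      (fun p => doubRootB p.1 p.2))

/-- The degree `d(α) = -∑ l, α_l G_l`. -/
def degB (n : ℕ) (α : Fin n → ℤ) : ℤ := -∑ l, α l * gB n l

/-- centred prefix sum -/
def hB (k : ℕ) : ℤ := if k % 4 = 1 ∨ k % 4 = 2 then 1 else -1

/-- centred prefix sum, with the last value being zero -/
def HB (n k : ℕ) : ℤ := if n ≤ k then 0 else hB k

lemma gB_eq_s13 (n : ℕ) (hn : n % 2 = 1) (i : Fin n) :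
    gB n i = HB n ((i : ℕ) + 1) - HB n i := by
  have := i.isLt
  unfold gB HB hB
  split_ifs <;> omega

lemma tele (H : ℕ → ℤ) (a b : ℕ) (hab : a ≤ b) (n : ℕ) :
    ∑ l ∈ Finset.range n, (if a ≤ l ∧ l < b then 1 else 0) * (H (l + 1) - H l)
      = H (min b n) - H (min a n) := by
  induction n with
  | zero => simp
  | succ n ih =>
    rw [Finset.sum_range_succ, ih]
    by_cases h1 : a ≤ n
    · by_cases h2 : n < b
      · rw [if_pos ⟨h1, h2⟩, min_eq_right h2.le, min_eq_left h1, min_eq_right (by omega : n + 1 ≤ b),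
          min_eq_left (by omega : a ≤ n + 1)]
        ring
      · rw [if_neg (by omega), min_eq_left (by omega : b ≤ n), min_eq_left h1,
          min_eq_left (by omega : b ≤ n + 1), min_eq_left (by omega : a ≤ n + 1)]
        ring
    · rw [if_neg (by omega), min_eq_right (by omega : n ≤ b), min_eq_right (by omega : n ≤ a),
          min_eq_right (by omega : n + 1 ≤ b), min_eq_right (by omega : n + 1 ≤ a)]
      ring

lemma deg_neg (n : ℕ) (hn : n % 2 = 1) (i : Fin n) :
    degB n (negRoot i) = HB n ((i : ℕ) + 1) - HB n i := by
  rw [← gB_eq_s13 n hn]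
  simp [degB, negRoot]

lemma deg_int (n : ℕ) (hn : n % 2 = 1) (i j : Fin n) (hij : i ≤ j) :
    degB n (intRoot i j) = HB n i - HB n ((j : ℕ) + 1) := by
  have h := tele (HB n) i (j + 1) (by have : (i : ℕ) ≤ j := hij
                                      omega) n
  have hi := i.isLt
  have hj := j.isLt
  rw [min_eq_left (by omega), min_eq_left (by omega), Finset.sum_range] at h
  have : degB n (intRoot i j) = -(HB n ((j : ℕ) + 1) - HB n i) := by
    rw [← h, degB]
    congr 1
    refine Finset.sum_congr rfl fun l _ => ?_
    rw [gB_eq_s13 n hn, intRoot]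
    simp only [Fin.le_def, Nat.lt_succ_iff]
  rw [this]; ring

lemma deg_doub (n : ℕ) (hn : n % 2 = 1) (i j : Fin n) (hij : i < j) :
    degB n (doubRootB i j) = HB n i + HB n j := by
  have hi := i.isLt
  have hj := j.isLt
  have hij' : (i : ℕ) < j := hij
  have h1 := tele (HB n) i n (by omega) n
  have h2 := tele (HB n) j n (by omega) n
  rw [min_eq_left (by omega), min_eq_left (by omega), Finset.sum_range] at h1 h2
  have hz : HB n n = 0 := by simp [HB]
  have : degB n (doubRootB i j) = -((HB n n - HB n i) + (HB n n - HB n j)) := by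
    rw [← h1, ← h2, degB, ← Finset.sum_add_distrib]
    congr 1
    refine Finset.sum_congr rfl fun l _ => ?_
    have hl := l.isLt
    rw [gB_eq_s13 n hn, doubRootB, ← add_mul]
    congr 1
    simp only [Fin.le_def, Fin.lt_def]
    split_ifs <;> omega
  rw [this, hz]; ring

lemma negRoot_inj {n : ℕ} : Function.Injective (negRoot (n := n)) := by
  intro i j h
  have := congrFun h i
  simp only [negRoot] at this
  split_ifs at this <;> simp_all

lemma intRoot_inj {n : ℕ} (i j i' j' : Fin n) (h1 : i ≤ j) (h2 : i' ≤ j')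
    (h : intRoot i j = intRoot i' j') : i = i' ∧ j = j' := by
  have a := congrFun h i
  have b := congrFun h j
  have c := congrFun h i'
  have d := congrFun h j'
  simp only [intRoot, Fin.le_def] at a b c d h1 h2
  simp only [Fin.ext_iff]
  split_ifs at a b c d <;> omega

lemma doub_eq_two {n : ℕ} (i j l : Fin n) : doubRootB i j l = 2 ↔ j ≤ l := by
  unfold doubRootB
  simp only [Fin.le_def, Fin.lt_def]
  split_ifs <;> omega

lemma doub_eq_zero {n : ℕ} (i j l : Fin n) (h : i < j) : doubRootB i j l = 0 ↔ l < i := by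
  unfold doubRootB
  simp only [Fin.le_def, Fin.lt_def] at h ⊢
  split_ifs <;> omega

lemma doub_inj {n : ℕ} (i j i' j' : Fin n) (h1 : i < j) (h2 : i' < j')
    (h : doubRootB i j = doubRootB i' j') : i = i' ∧ j = j' := by
  have a : ∀ l, j ≤ l ↔ j' ≤ l := fun l => by
    rw [← doub_eq_two i j l, ← doub_eq_two i' j' l, h]
  have b : ∀ l, l < i ↔ l < i' := fun l => by
    rw [← doub_eq_zero i j l h1, ← doub_eq_zero i' j' l h2, h]
  refine ⟨le_antisymm ?_ ?_, le_antisymm ((a j').2 le_rfl) ((a j).1 le_rfl)⟩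
  · exact not_lt.1 fun hh => lt_irrefl _ ((b i').1 hh)
  · exact not_lt.1 fun hh => lt_irrefl _ ((b i).2 hh)

lemma card_pairs_le (n : ℕ) (q : ℕ → ℕ → Prop) [∀ i j, Decidable (q i j)] :
    (((Finset.univ ×ˢ Finset.univ).filter (fun p : Fin n × Fin n => p.1 ≤ p.2)).filter
      (fun p => q p.1 p.2)).card
    = ∑ j ∈ Finset.range n, ∑ i ∈ Finset.range (j + 1), if q i j then 1 else 0 := by
  rw [Finset.filter_filter, Finset.card_filter, Finset.sum_product_right, Finset.sum_range]
  refine Finset.sum_congr rfl fun j _ => ?_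
  have hj := j.isLt
  simp only [Fin.le_def]
  rw [← Finset.sum_range (fun i => if i ≤ (j : ℕ) ∧ q i j then 1 else 0)]
  symm
  rw [← Finset.sum_subset (Finset.range_subset_range.2 (show (j : ℕ) + 1 ≤ n by omega))]
  · refine Finset.sum_congr rfl fun i hi => ?_
    have : i ≤ (j : ℕ) := by simpa [Nat.lt_succ_iff] using hi
    simp [this]
  · intro x _ hx
    have : ¬ x ≤ (j : ℕ) := by simpa [Nat.lt_succ_iff] using hx
    simp [this]

lemma card_pairs_lt (n : ℕ) (q : ℕ → ℕ → Prop) [∀ i j, Decidable (q i j)] :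
    (((Finset.univ ×ˢ Finset.univ).filter (fun p : Fin n × Fin n => p.1 < p.2)).filter
      (fun p => q p.1 p.2)).card
    = ∑ j ∈ Finset.range n, ∑ i ∈ Finset.range j, if q i j then 1 else 0 := by
  rw [Finset.filter_filter, Finset.card_filter, Finset.sum_product_right, Finset.sum_range]
  refine Finset.sum_congr rfl fun j _ => ?_
  have hj := j.isLt
  simp only [Fin.lt_def]
  rw [← Finset.sum_range (fun i => if i < (j : ℕ) ∧ q i j then 1 else 0)]
  symm
  rw [← Finset.sum_subset (Finset.range_subset_range.2 (show (j : ℕ) ≤ n by omega))]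
  · refine Finset.sum_congr rfl fun i hi => ?_
    have : i < (j : ℕ) := by simpa using hi
    simp [this]
  · intro x _ hx
    have : ¬ x < (j : ℕ) := by simpa using hx
    simp [this]

lemma card_phi (n : ℕ) (hn : n % 2 = 1) (c : ℤ) :
    ((PhiB n).filter (fun α => degB n α = c)).card =
      (∑ i ∈ Finset.range n, if HB n (i + 1) - HB n i = c then 1 else 0) +
      (∑ j ∈ Finset.range n, ∑ i ∈ Finset.range (j + 1),
        if HB n i - HB n (j + 1) = c then 1 else 0) +
      (∑ j ∈ Finset.range n, ∑ i ∈ Finset.range j,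
        if HB n i + HB n j = c then 1 else 0) := by
  rw [PhiB, Finset.filter_union, Finset.filter_union, Finset.card_union_of_disjoint,
    Finset.card_union_of_disjoint]
  · congr 1
    · congr 1
      · rw [Finset.filter_image, Finset.card_image_of_injective _ negRoot_inj,
          Finset.card_filter, Finset.sum_range]
        simp only [deg_neg n hn]
      · rw [← card_pairs_le n (fun i j => HB n i - HB n (j + 1) = c), Finset.filter_image,
          Finset.card_image_of_injOn]
        · congr 1
          refine Finset.filter_congr fun p hp => ?_
          rw [deg_int n hn _ _ (by simpa using hp)]
        · intro p hp p' hp' h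
          simp only [Finset.coe_filter, Finset.mem_filter, Set.mem_ofPred_eq] at hp hp'
          have := intRoot_inj _ _ _ _ hp.1.2 hp'.1.2 h
          exact Prod.ext this.1 this.2
    · rw [← card_pairs_lt n (fun i j => HB n i + HB n j = c), Finset.filter_image,
          Finset.card_image_of_injOn]
      · congr 1
        refine Finset.filter_congr fun p hp => ?_
        rw [deg_doub n hn _ _ (by simpa using hp)]
      · intro p hp p' hp' h
        simp only [Finset.coe_filter, Finset.mem_filter, Set.mem_ofPred_eq] at hp hp'
        have := doub_inj _ _ _ _ hp.1.2 hp'.1.2 h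
        exact Prod.ext this.1 this.2
  · apply Finset.disjoint_filter_filter
    rw [Finset.disjoint_left]
    intro x hx hx'
    simp only [Finset.mem_image, Finset.mem_filter] at hx hx'
    obtain ⟨i, _, rfl⟩ := hx
    obtain ⟨p, _, h⟩ := hx'
    have := congrFun h i
    simp only [negRoot, intRoot] at this
    split_ifs at this <;> omega
  · rw [← Finset.filter_union]
    apply Finset.disjoint_filter_filter
    rw [Finset.disjoint_left]
    intro x hx hx'
    simp only [Finset.mem_union, Finset.mem_image, Finset.mem_filter] at hx hx'
    obtain ⟨p, ⟨_, hp⟩, h⟩ := hx'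
    have := congrFun h p.2
    simp only [doubRootB, lt_irrefl, and_false, if_false, le_refl, if_true] at this
    rcases hx with ⟨i, _, rfl⟩ | ⟨q, _, rfl⟩
    · simp only [negRoot] at this
      split_ifs at this <;> omega
    · simp only [intRoot] at this
      split_ifs at this <;> omega

lemma card_phi' (m : ℕ) (c : ℤ) :
    ((PhiB (2 * m + 1)).filter (fun α => degB (2 * m + 1) α = c)).card =
      (∑ j ∈ Finset.range (2 * m), ((if hB (j + 1) - hB j = c then 1 else 0) +
        ∑ i ∈ Finset.range (j + 1), ((if hB i - hB (j + 1) = c then 1 else 0) +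
          (if hB i + hB (j + 1) = c then 1 else 0)))) +
      ((if - hB (2 * m) = c then 1 else 0) +
      ∑ i ∈ Finset.range (2 * m + 1), if hB i = c then 1 else 0) := by
  have key : ∀ k, k < 2 * m + 1 → HB (2 * m + 1) k = hB k := fun k hk => by
    rw [HB, if_neg (by omega)]
  have key' : HB (2 * m + 1) (2 * m + 1) = 0 := by simp [HB]
  rw [card_phi _ (by omega), Finset.sum_range_succ (n := 2 * m),
    Finset.sum_range_succ (n := 2 * m), Finset.sum_range_succ' (fun j => ∑ i ∈ Finset.range j,
      if HB (2 * m + 1) i + HB (2 * m + 1) j = c then 1 else 0) (2 * m), key',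
    key _ (Nat.lt_succ_self _)]
  simp only [Finset.sum_add_distrib, Finset.range_zero, Finset.sum_empty, zero_sub, sub_zero,
    add_zero]
  have e1 : (∑ i ∈ Finset.range (2 * m),
      if HB (2 * m + 1) (i + 1) - HB (2 * m + 1) i = c then 1 else 0)
      = ∑ i ∈ Finset.range (2 * m), if hB (i + 1) - hB i = c then 1 else 0 := by
    refine Finset.sum_congr rfl fun i hi => ?_
    rw [Finset.mem_range] at hi
    rw [key _ (by omega), key _ (by omega)]
  have e2 : (∑ j ∈ Finset.range (2 * m), ∑ i ∈ Finset.range (j + 1),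
      if HB (2 * m + 1) i - HB (2 * m + 1) (j + 1) = c then 1 else 0)
      = ∑ j ∈ Finset.range (2 * m), ∑ i ∈ Finset.range (j + 1),
        if hB i - hB (j + 1) = c then 1 else 0 := by
    refine Finset.sum_congr rfl fun j hj => Finset.sum_congr rfl fun i hi => ?_
    rw [Finset.mem_range] at hi hj
    rw [key _ (by omega), key _ (by omega)]
  have e3 : (∑ j ∈ Finset.range (2 * m), ∑ i ∈ Finset.range (j + 1),
      if HB (2 * m + 1) i + HB (2 * m + 1) (j + 1) = c then 1 else 0)
      = ∑ j ∈ Finset.range (2 * m), ∑ i ∈ Finset.range (j + 1),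
        if hB i + hB (j + 1) = c then 1 else 0 := by
    refine Finset.sum_congr rfl fun j hj => Finset.sum_congr rfl fun i hi => ?_
    rw [Finset.mem_range] at hi hj
    rw [key _ (by omega), key _ (by omega)]
  have e4 : (∑ i ∈ Finset.range (2 * m + 1), if HB (2 * m + 1) i = c then 1 else 0)
      = ∑ i ∈ Finset.range (2 * m + 1), if hB i = c then 1 else 0 := by
    refine Finset.sum_congr rfl fun i hi => ?_
    rw [Finset.mem_range] at hi
    rw [key _ (by omega)]
  rw [e1, e2, e3, e4]
  ring

lemma hB_cases (k : ℕ) : hB k = 1 ∨ hB k = -1 := by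
  unfold hB; split_ifs <;> simp

lemma cnt_pos (k : ℕ) : (∑ i ∈ Finset.range k, if hB i = 1 then 1 else 0)
    = 2 * (k / 4) + (k % 4 - 1) := by
  induction k with
  | zero => simp
  | succ k ih =>
    rw [Finset.sum_range_succ, ih]
    unfold hB
    split_ifs <;> first | omega | simp_all

lemma cnt_neg (k : ℕ) : (∑ i ∈ Finset.range k, if hB i = -1 then 1 else 0)
    = k - (2 * (k / 4) + (k % 4 - 1)) := by
  induction k with
  | zero => simp
  | succ k ih =>
    rw [Finset.sum_range_succ, ih]
    unfold hB
    split_ifs <;> first | omega | simp_all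

lemma inner_two (k : ℕ) : (∑ i ∈ Finset.range k, ((if hB i - hB k = 2 then 1 else 0) +
      (if hB i + hB k = 2 then 1 else 0))) = 2 * (k / 4) + (k % 4 - 1) := by
  rw [← cnt_pos]
  refine Finset.sum_congr rfl fun i _ => ?_
  rcases hB_cases i with h | h <;> rcases hB_cases k with h' | h' <;> rw [h, h'] <;> norm_num

lemma inner_neg_two (k : ℕ) : (∑ i ∈ Finset.range k, ((if hB i - hB k = -2 then 1 else 0) +
      (if hB i + hB k = -2 then 1 else 0))) = k - (2 * (k / 4) + (k % 4 - 1)) := by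
  rw [← cnt_neg]
  refine Finset.sum_congr rfl fun i _ => ?_
  rcases hB_cases i with h | h <;> rcases hB_cases k with h' | h' <;> rw [h, h'] <;> norm_num

lemma inner_zero (k : ℕ) : (∑ i ∈ Finset.range k, ((if hB i - hB k = 0 then 1 else 0) +
      (if hB i + hB k = 0 then 1 else 0))) = k := by
  conv_rhs => rw [← Finset.card_range k, Finset.card_eq_sum_ones]
  refine Finset.sum_congr rfl fun i _ => ?_
  rcases hB_cases i with h | h <;> rcases hB_cases k with h' | h' <;> rw [h, h'] <;> norm_num

lemma inner_one (k : ℕ) (c : ℤ) (hc : c = 1 ∨ c = -1) :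
    (∑ i ∈ Finset.range k, ((if hB i - hB k = c then 1 else 0) +
      (if hB i + hB k = c then 1 else 0))) = 0 := by
  refine Finset.sum_eq_zero fun i _ => ?_
  rcases hB_cases i with h | h <;> rcases hB_cases k with h' | h' <;> rw [h, h'] <;>
    rcases hc with rfl | rfl <;> norm_num

lemma diff_two (k : ℕ) : (if hB (k + 1) - hB k = 2 then 1 else 0) = if k % 4 = 0 then 1 else 0 := by
  unfold hB
  split_ifs <;> omega

lemma diff_neg_two (k : ℕ) :
    (if hB (k + 1) - hB k = -2 then 1 else 0) = if k % 4 = 2 then 1 else 0 := by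
  unfold hB
  split_ifs <;> omega

lemma diff_zero (k : ℕ) : (if hB (k + 1) - hB k = 0 then 1 else 0) = k % 2 := by
  unfold hB
  split_ifs <;> omega

lemma diff_one (k : ℕ) (c : ℤ) (hc : c = 1 ∨ c = -1) :
    (if hB (k + 1) - hB k = c then 1 else 0) = 0 := by
  rcases hB_cases (k + 1) with h | h <;> rcases hB_cases k with h' | h' <;> rw [h, h'] <;>
    rcases hc with rfl | rfl <;> norm_num

lemma tail_zero (m : ℕ) (c : ℤ) (h1 : c ≠ 1) (h2 : c ≠ -1) :
    ((if - hB (2 * m) = c then 1 else 0) +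
      ∑ i ∈ Finset.range (2 * m + 1), if hB i = c then 1 else 0) = 0 := by
  have : ∀ i, hB i ≠ c := fun i h => by
    rcases hB_cases i with h' | h'
    · exact h1 (h.symm.trans h')
    · exact h2 (h.symm.trans h')
  have h3 : - hB (2 * m) ≠ c := fun h => by
    rcases hB_cases (2 * m) with h' | h' <;> rw [h'] at h
    · exact h2 h.symm
    · exact h1 (by rw [← h]; norm_num)
  simp [this, h3]

lemma count_two (m : ℕ) :
    ((PhiB (2 * m + 1)).filter (fun α => degB (2 * m + 1) α = 2)).card = m * (m + 1) := by
  rw [card_phi', tail_zero _ _ (by norm_num) (by norm_num)]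
  simp only [inner_two, diff_two, add_zero]
  induction m with
  | zero => simp
  | succ m ih =>
    rw [show 2 * (m + 1) = 2 * m + 1 + 1 by ring, Finset.sum_range_succ, Finset.sum_range_succ, ih,
      show (m + 1) * (m + 1 + 1) = m * (m + 1) + (2 * m + 2) by ring]
    split_ifs <;> omega

lemma count_neg_two (m : ℕ) :
    ((PhiB (2 * m + 1)).filter (fun α => degB (2 * m + 1) α = -2)).card = m * (m + 1) := by
  rw [card_phi', tail_zero _ _ (by norm_num) (by norm_num)]
  simp only [inner_neg_two, diff_neg_two, add_zero]
  induction m with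
  | zero => simp
  | succ m ih =>
    rw [show 2 * (m + 1) = 2 * m + 1 + 1 by ring, Finset.sum_range_succ, Finset.sum_range_succ, ih,
      show (m + 1) * (m + 1 + 1) = m * (m + 1) + (2 * m + 2) by ring]
    split_ifs <;> omega

lemma count_zero (m : ℕ) :
    ((PhiB (2 * m + 1)).filter (fun α => degB (2 * m + 1) α = 0)).card = 2 * (m * (m + 1)) := by
  rw [card_phi', tail_zero _ _ (by norm_num) (by norm_num)]
  simp only [inner_zero, diff_zero, add_zero]
  induction m with
  | zero => simp
  | succ m ih =>
    rw [show 2 * (m + 1) = 2 * m + 1 + 1 by ring, Finset.sum_range_succ, Finset.sum_range_succ, ih,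
      show (m + 1) * (m + 1 + 1) = m * (m + 1) + (2 * m + 2) by ring]
    omega

lemma count_one (m : ℕ) :
    ((PhiB (2 * m + 1)).filter (fun α => degB (2 * m + 1) α = 1)).card = m + 1 := by
  rw [card_phi']
  simp only [inner_one _ 1 (Or.inl rfl), diff_one _ 1 (Or.inl rfl), add_zero,
    Finset.sum_const_zero, zero_add, cnt_pos]
  by_cases h : 2 * m % 4 = 2
  · have e : hB (2 * m) = 1 := by rw [hB, if_pos (Or.inr h)]
    rw [e, if_neg (by norm_num)]
    omega
  · have e : hB (2 * m) = -1 := by rw [hB, if_neg (by omega)]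
    rw [e, if_pos (by norm_num)]
    omega

lemma count_neg_one (m : ℕ) :
    ((PhiB (2 * m + 1)).filter (fun α => degB (2 * m + 1) α = -1)).card = m + 1 := by
  rw [card_phi']
  simp only [inner_one _ (-1) (Or.inr rfl), diff_one _ (-1) (Or.inr rfl), add_zero,
    Finset.sum_const_zero, zero_add, cnt_neg]
  unfold hB
  split_ifs <;> omega

lemma HB_cases (n k : ℕ) : (n ≤ k ∧ HB n k = 0) ∨ (k < n ∧ (HB n k = 1 ∨ HB n k = -1)) := by
  unfold HB
  split_ifs with h
  · exact Or.inl ⟨h, rfl⟩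
  · exact Or.inr ⟨by omega, hB_cases k⟩

/-- for odd `n ≥ 3`, all degrees lie in `{-2, -1, 0, 1, 2}`, with
`(n+1)(n-1)/4` roots of degree `2`, `(n+1)/2` of degree `1`, `(n+1)(n-1)/2` of degree `0`,
`(n+1)/2` of degree `-1` and `(n+1)(n-1)/4` of degree `-2`.  In particular this grading
of the coefficient-free type `B_n` cluster algebra is balanced. -/
theorem degree_distribution_B (n : ℕ) (hn3 : 3 ≤ n) (hn : n % 2 = 1) :
    (∀ α ∈ PhiB n, degB n α ∈ ({-2, -1, 0, 1, 2} : Set ℤ)) ∧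
    ((PhiB n).filter (fun α => degB n α = 2)).card = (n + 1) * (n - 1) / 4 ∧
    ((PhiB n).filter (fun α => degB n α = 1)).card = (n + 1) / 2 ∧
    ((PhiB n).filter (fun α => degB n α = 0)).card = (n + 1) * (n - 1) / 2 ∧
    ((PhiB n).filter (fun α => degB n α = -1)).card = (n + 1) / 2 ∧
    ((PhiB n).filter (fun α => degB n α = -2)).card = (n + 1) * (n - 1) / 4 := by
  refine ⟨?_, ?_⟩
  · intro α hα
    have : -2 ≤ degB n α ∧ degB n α ≤ 2 := by
      simp only [PhiB, Finset.mem_union, Finset.mem_image, Finset.mem_filter] at hα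
      rcases hα with (⟨i, _, rfl⟩ | ⟨p, hp, rfl⟩) | ⟨p, hp, rfl⟩
      · rw [deg_neg n hn]
        have a := HB_cases n i
        have b := HB_cases n (i + 1)
        omega
      · rw [deg_int n hn _ _ hp.2]
        have a := HB_cases n p.1
        have b := HB_cases n (p.2 + 1)
        omega
      · rw [deg_doub n hn _ _ hp.2]
        have a := HB_cases n p.1
        have b := HB_cases n p.2
        omega
    simp only [Set.mem_insert_iff, Set.mem_singleton_iff]
    omega
  · obtain ⟨m, rfl⟩ : ∃ m, n = 2 * m + 1 := ⟨n / 2, by omega⟩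
    have e : (2 * m + 1 + 1) * (2 * m + 1 - 1) = 4 * (m * (m + 1)) := by
      rw [Nat.add_sub_cancel]; ring
    rw [count_two, count_one, count_zero, count_neg_one, count_neg_two, e]
    refine ⟨?_, ?_, ?_, ?_, ?_⟩ <;> omega
end
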